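/- arXiv:2102.06886 — 2 statements merged into one kernel-verified Lean document; each statement's English description precedes it below -/
import Mathlib

section
/- (Connectivity of the chessboard complex Δ_{r,2r-1}.) Let r ≥ 2. The configuration space C₂ (the geometric realization of the chessboard complex Δ_{r,2r-1}) is (r−2)-connected: it is nonempty, path-connected, and for every natural number n with 1 ≤ n ≤ r−2 and every basepoint x ∈ C₂, the n-th homotopy group πₙ(C₂, x) is trivial (a subsingleton). -/
/-- The configuration space `C₂`, the geometric realization of the chessboard
complex `Δ_{r,2r-1}`: matrices with nonnegative entries summing to `1`,
at most one nonzero entry in each row, and at most one nonzero entry in each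
column. -/
def ConfC2 (r : ℕ) : Set (Fin r → Fin (2 * r - 1) → ℝ) :=
  {M | (∀ b t, 0 ≤ M b t) ∧ (∑ b, ∑ t, M b t) = 1 ∧
    (∀ b t t', M b t ≠ 0 → M b t' ≠ 0 → t = t') ∧
    (∀ t b b', M b t ≠ 0 → M b' t ≠ 0 → b = b')}

section Dimension

/-- The set `S` has (large inductive) dimension less than `d`: any two disjoint closed subsets of
`S` are separated by a set of dimension less than `d - 1`. -/
def DimLT {Z : Type*} [TopologicalSpace Z] : ℕ → Set Z → Prop
  | 0, S => S = ∅
  | d + 1, S => ∀ C D : Set Z, IsClosed C → IsClosed D → C ⊆ S → D ⊆ S → Disjoint C D →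
      ∃ U V : Set Z, IsOpen U ∧ IsOpen V ∧ Disjoint U V ∧ C ⊆ U ∧ D ⊆ V ∧
        DimLT d (S \ (U ∪ V))

theorem DimLT.mono {Z : Type*} [TopologicalSpace Z] {d : ℕ} {S S' : Set Z} (h : DimLT d S)
    (hS : S' ⊆ S) : DimLT d S' := by
  induction d generalizing S S' with
  | zero => exact Set.subset_empty_iff.1 (hS.trans (Set.subset_empty_iff.2 h))
  | succ d ih =>
    intro C D hC hD hCS hDS hCD
    obtain ⟨U, V, hU, hV, hUV, hCU, hDV, hd⟩ := h C D hC hD (hCS.trans hS) (hDS.trans hS) hCD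
    exact ⟨U, V, hU, hV, hUV, hCU, hDV, ih hd (Set.sdiff_subset_sdiff_left hS)⟩

/-- A compact set can be separated from a disjoint closed set by a finite union of boxes whose
walls avoid a prescribed finite set of coordinate values. -/
theorem exists_isOpen_frontier_subset_walls {κ : Type*} [Fintype κ] {C D : Set (κ → ℝ)}
    (hC : IsCompact C) (hD : IsClosed D) (hCD : Disjoint C D) {T : Set ℝ} (hT : T.Finite) :
    ∃ U : Set (κ → ℝ), IsOpen U ∧ C ⊆ U ∧ Disjoint (closure U) D ∧
      ∃ T' : Set ℝ, T'.Finite ∧ Disjoint T T' ∧ frontier U ⊆ {x | ∃ i, x i ∈ T'} := by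
  refine hC.induction_on (p := fun C => ∃ U : Set (κ → ℝ), IsOpen U ∧ C ⊆ U ∧
      Disjoint (closure U) D ∧ ∃ T' : Set ℝ, T'.Finite ∧ Disjoint T T' ∧
        frontier U ⊆ {x | ∃ i, x i ∈ T'}) ?_ ?_ ?_ ?_
  · exact ⟨∅, isOpen_empty, subset_rfl, by simp, ∅, Set.finite_empty, by simp, by simp⟩
  · rintro s t hst ⟨U, hU, htU, h⟩
    exact ⟨U, hU, hst.trans htU, h⟩
  · rintro s t ⟨U, hU, hsU, hUD, T₁, hT₁, hTT₁, hF₁⟩ ⟨V, hV, htV, hVD, T₂, hT₂, hTT₂, hF₂⟩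
    refine ⟨U ∪ V, hU.union hV, Set.union_subset_union hsU htV, ?_, T₁ ∪ T₂, hT₁.union hT₂, ?_, ?_⟩
    · rw [closure_union]
      exact Set.disjoint_union_left.2 ⟨hUD, hVD⟩
    · exact Set.disjoint_union_right.2 ⟨hTT₁, hTT₂⟩
    · intro x hx
      rcases frontier_union_subset U V hx with h | h
      · obtain ⟨i, hi⟩ := hF₁ h.1
        exact ⟨i, Or.inl hi⟩
      · obtain ⟨i, hi⟩ := hF₂ h.2
        exact ⟨i, Or.inr hi⟩
  · intro x hx
    have hxD : x ∉ D := Set.disjoint_left.1 hCD hx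
    obtain ⟨ε₀, hε₀, hball⟩ := Metric.isOpen_iff.1 hD.isOpen_compl x hxD
    have hbad : (⋃ i, ((fun ε : ℝ => x i + ε) ⁻¹' T ∪ (fun ε : ℝ => x i - ε) ⁻¹' T)).Finite := by
      refine Set.finite_iUnion fun i => ?_
      exact (hT.preimage (add_right_injective (x i)).injOn).union
        (hT.preimage (sub_right_injective (b := x i)).injOn)
    obtain ⟨ε, ⟨hε, hεε⟩, hgood⟩ := ((Set.Ioo_infinite hε₀).sdiff hbad).nonempty
    have hgood' : ∀ i, x i + ε ∉ T ∧ x i - ε ∉ T := by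
      simpa [not_or] using hgood
    refine ⟨Metric.ball x ε, mem_nhdsWithin_of_mem_nhds (Metric.ball_mem_nhds x hε),
      Metric.ball x ε, Metric.isOpen_ball, subset_rfl, ?_,
      ⋃ i, {x i + ε, x i - ε}, Set.finite_iUnion fun i => by simp, ?_, ?_⟩
    · refine Set.disjoint_left.2 fun z hz => ?_
      exact hball (Metric.closedBall_subset_ball hεε (Metric.closure_ball_subset_closedBall hz))
    · refine Set.disjoint_right.2 fun z hz => ?_
      obtain ⟨i, hi⟩ := Set.mem_iUnion.1 hz
      rcases hi with rfl | rfl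
      · exact (hgood' i).1
      · exact (hgood' i).2
    · intro z hz
      have hz' : dist z x = ε := Metric.frontier_ball_subset_sphere hz
      have hne : Nonempty κ := by
        by_contra hemp
        rw [not_nonempty_iff] at hemp
        rw [Subsingleton.elim z x, dist_self] at hz'
        exact hε.ne hz'
      obtain ⟨i, hi⟩ : ∃ i, dist (z i) (x i) = ε := by
        by_contra! hcon
        have : dist z x < ε := (dist_pi_lt_iff hε).2 fun i =>
          lt_of_le_of_ne (hz' ▸ dist_le_pi_dist z x i) (hcon i)
        exact this.ne hz'
      refine ⟨i, Set.mem_iUnion.2 ⟨i, ?_⟩⟩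
      rw [Real.dist_eq] at hi
      rcases eq_or_eq_neg_of_abs_eq hi with h | h
      · left; linarith
      · right; rw [Set.mem_singleton_iff]; linarith

/-- A compact set of points with more than `|κ| - d` coordinates in a fixed finite set has
dimension less than `d`. -/
theorem dimLT_of_coordinates_mem {κ : Type*} [Fintype κ] (d : ℕ) {S : Set (κ → ℝ)}
    (hS : IsCompact S) {T : Set ℝ} (hT : T.Finite)
    (h : ∀ x ∈ S, Fintype.card κ < {i | x i ∈ T}.ncard + d) :
    DimLT d S := by
  induction d generalizing S T with
  | zero =>
    refine Set.eq_empty_of_forall_notMem fun x hx => ?_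
    exact absurd (h x hx) (not_lt.2 ((Set.ncard_le_card _).trans_eq Nat.card_eq_fintype_card))
  | succ d ih =>
    intro C D hC hD hCS _ hCD
    obtain ⟨U, hU, hCU, hUD, T', hT', hTT', hF⟩ :=
      exists_isOpen_frontier_subset_walls (hS.of_isClosed_subset hC hCS) hD hCD hT
    refine ⟨U, (closure U)ᶜ, hU, isClosed_closure.isOpen_compl,
      disjoint_compl_right.mono_left subset_closure, hCU, hUD.subset_compl_left,
      ih (hS.diff (hU.union isClosed_closure.isOpen_compl)) (hT.union hT') ?_⟩
    rintro x ⟨hxS, hxU⟩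
    have hxF : x ∈ frontier U := by
      rw [hU.frontier_eq]
      simpa [not_or, and_comm] using hxU
    obtain ⟨i, hi⟩ := hF hxF
    have hlt : {i | x i ∈ T}.ncard < {i | x i ∈ T ∪ T'}.ncard :=
      Set.ncard_lt_ncard ⟨fun j hj => Or.inl hj, fun hcon =>
        Set.disjoint_left.1 hTT' (hcon (Or.inr hi : x i ∈ T ∪ T')) hi⟩
    have := h x hxS
    omega

theorem IsCompact.dimLT {κ : Type*} [Fintype κ] {S : Set (κ → ℝ)} (hS : IsCompact S) {d : ℕ}
    (hd : Fintype.card κ < d) : DimLT d S :=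
  dimLT_of_coordinates_mem d hS Set.finite_empty fun x _ => by omega

end Dimension

section IndependenceComplex

/-- The independence complex of `G` restricted to the vertex set `W`, realized up to positive
scaling of its barycentric coordinates: nonzero nonnegative functions supported on an independent
subset of `W`. -/
def indepRealization {ι : Type*} (G : SimpleGraph ι) (W : Set ι) : Set (ι → ℝ) :=
  {x | (∀ i, 0 ≤ x i) ∧ (∀ i, x i ≠ 0 → i ∈ W) ∧ (∀ i j, G.Adj i j → x i = 0 ∨ x j = 0) ∧
    ∃ i, x i ≠ 0}

/-- Continuous maps into `X` extend from closed subsets of sets of dimension less than `d`. -/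
def ExtendsBelow (Z : Type*) [TopologicalSpace Z] {Y : Type*} [TopologicalSpace Y] (d : ℕ)
    (X : Set Y) : Prop :=
  ∀ S A : Set Z, IsClosed S → DimLT d S → IsClosed A → A ⊆ S → ∀ f : Z → Y,
    ContinuousOn f A → Set.MapsTo f A X →
      ∃ g : Z → Y, ContinuousOn g S ∧ Set.MapsTo g S X ∧ Set.EqOn g f A

theorem exists_continuous_eqOn {ι Z : Type*} [TopologicalSpace Z] [NormalSpace Z] {A : Set Z}
    (hA : IsClosed A) {f : Z → ι → ℝ} (hf : ContinuousOn f A) :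
    ∃ g : Z → ι → ℝ, Continuous g ∧ Set.EqOn g f A := by
  obtain ⟨g, hg⟩ := ContinuousMap.exists_restrict_eq hA
    (⟨A.domRestrict f, hf.domRestrict⟩ : C(A, ι → ℝ))
  exact ⟨g, g.continuous, fun z hz => congrArg (fun k : C(A, ι → ℝ) => k ⟨z, hz⟩) hg⟩

variable {ι : Type*} [Fintype ι] (G : SimpleGraph ι)

open Classical in
/-- Subtract from each coordinate the sum of the adjacent ones, and take the positive part. -/
noncomputable def indepRetraction (x : ι → ℝ) (i : ι) : ℝ :=
  max 0 (x i - ∑ j, if G.Adj i j then x j else 0)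

theorem continuous_indepRetraction : Continuous (indepRetraction G) := by
  classical
  refine continuous_pi fun i => continuous_const.max ((continuous_apply i).sub ?_)
  refine continuous_finsetSum _ fun j _ => ?_
  split_ifs <;> fun_prop

variable {G}

theorem indepRetraction_of_isolated {x : ι → ℝ} (hx : ∀ i, 0 ≤ x i) {i : ι}
    (h : ∀ j, G.Adj i j → x j = 0) : indepRetraction G x i = x i := by
  classical
  have : ∑ j, (if G.Adj i j then x j else 0) = 0 :=
    Finset.sum_eq_zero fun j _ => by
      split_ifs with hj
      · exact h j hj
      · rfl
  rw [indepRetraction, this, sub_zero, max_eq_right (hx i)]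

theorem indepRetraction_le {x : ι → ℝ} (hx : ∀ i, 0 ≤ x i) (i : ι) :
    indepRetraction G x i ≤ x i := by
  classical
  refine max_le (hx i) (sub_le_self _ (Finset.sum_nonneg fun j _ => ?_))
  split_ifs
  exacts [hx j, le_rfl]

theorem indepRetraction_eq_zero_or {x : ι → ℝ} (hx : ∀ i, 0 ≤ x i) {i j : ι} (h : G.Adj i j) :
    indepRetraction G x i = 0 ∨ indepRetraction G x j = 0 := by
  classical
  have key : ∀ {a b : ι}, G.Adj a b → x a ≤ x b → indepRetraction G x a = 0 := by
    intro a b hab hle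
    refine max_eq_left ?_
    have := Finset.single_le_sum (f := fun j => if G.Adj a j then x j else 0)
      (fun j _ => by split_ifs; exacts [hx j, le_rfl]) (Finset.mem_univ b)
    simp only [hab, if_true] at this
    linarith
  rcases le_total (x i) (x j) with hle | hle
  · exact Or.inl (key h hle)
  · exact Or.inr (key h.symm hle)

theorem indepRetraction_eq_self {x : ι → ℝ} {W : Set ι} (hx : x ∈ indepRealization G W) :
    indepRetraction G x = x := by
  funext i
  by_cases hi : x i = 0
  · exact le_antisymm (indepRetraction_le hx.1 i) (hi.trans_le (le_max_left _ _))
  · exact indepRetraction_of_isolated hx.1 fun j hj => (hx.2.2.1 i j hj).resolve_left hi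

theorem indepRetraction_mem {x : ι → ℝ} {W : Set ι} (hx : ∀ i, 0 ≤ x i)
    (hW : ∀ i, x i ≠ 0 → i ∈ W) (hne : ∃ i, x i ≠ 0 ∧ ∀ j, G.Adj i j → x j = 0) :
    indepRetraction G x ∈ indepRealization G W := by
  refine ⟨fun i => le_max_left _ _, fun i hi => hW i fun h => hi ?_, fun i j h =>
    indepRetraction_eq_zero_or hx h, ?_⟩
  · exact le_antisymm ((indepRetraction_le hx i).trans_eq h) (le_max_left _ _)
  · obtain ⟨i, hi, hj⟩ := hne
    exact ⟨i, by rwa [indepRetraction_of_isolated hx hj]⟩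

variable {Z : Type*} [MetricSpace Z]

/-- A vertex set with a vertex adjacent to no other one realizes to a cone, hence to an absolute
extensor. -/
theorem exists_extension_of_cone {W : Set ι} {v : ι} (hv : v ∈ W) (hvW : ∀ w ∈ W, ¬ G.Adj v w)
    {A : Set Z} (hA : IsClosed A) {f : Z → ι → ℝ} (hf : ContinuousOn f A)
    (hfX : Set.MapsTo f A (indepRealization G W)) :
    ∃ g : Z → ι → ℝ, Continuous g ∧ (∀ z, g z ∈ indepRealization G W) ∧ Set.EqOn g f A := by
  classical
  obtain ⟨u, hu, hu0, huA⟩ : ∃ u : Z → ℝ, Continuous u ∧ (∀ z, 0 ≤ u z) ∧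
      ∀ z, u z = 0 ↔ z ∈ A := by
    rcases A.eq_empty_or_nonempty with rfl | hne
    · exact ⟨fun _ => 1, continuous_const, fun _ => zero_le_one, fun z => by simp⟩
    · exact ⟨fun z => Metric.infDist z A, Metric.continuous_infDist_pt A,
        fun z => Metric.infDist_nonneg, fun z => (hA.mem_iff_infDist_zero hne).symm⟩
  obtain ⟨k, hk, hkf⟩ := exists_continuous_eqOn hA hf
  let l : Z → ι → ℝ := fun z i =>
    if i ∈ W then |k z i| + (if i = v then u z else 0) else 0
  have hl : Continuous l := by
    refine continuous_pi fun i => ?_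
    simp only [l]
    split_ifs <;> fun_prop
  have hl0 : ∀ z i, 0 ≤ l z i := by
    intro z i
    have := hu0 z
    simp only [l]
    split_ifs <;> positivity
  have hlW : ∀ z i, l z i ≠ 0 → i ∈ W := by
    intro z i h
    by_contra hi
    exact h (if_neg hi)
  have hlf : ∀ z ∈ A, l z = f z := by
    intro z hz
    funext i
    simp only [l, hkf hz, (huA z).2 hz, ite_self, add_zero, abs_of_nonneg ((hfX hz).1 i)]
    split_ifs with hi
    · rfl
    · by_contra h
      exact hi ((hfX hz).2.1 i (Ne.symm h))
  have hfix : ∀ z ∈ A, indepRetraction G (l z) = f z := by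
    intro z hz
    rw [hlf z hz, indepRetraction_eq_self (hfX hz)]
  refine ⟨fun z => indepRetraction G (l z), (continuous_indepRetraction G).comp hl, fun z => ?_,
    hfix⟩
  by_cases hz : z ∈ A
  · exact (congrArg (· ∈ indepRealization G W) (hfix z hz)).mpr (hfX hz)
  · refine indepRetraction_mem (hl0 z) (hlW z) ⟨v, ?_, fun j hj => ?_⟩
    · have huz : 0 < u z := lt_of_le_of_ne (hu0 z) fun h => hz ((huA z).1 h.symm)
      simp only [l, hv, if_true]
      positivity
    · by_contra h
      exact hvW j (hlW z j h) hj

theorem extendsBelow_of_cone {W : Set ι} {v : ι} (hv : v ∈ W) (hvW : ∀ w ∈ W, ¬ G.Adj v w)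
    (d : ℕ) : ExtendsBelow Z d (indepRealization G W) := by
  intro S A _ _ hA _ f hf hfX
  obtain ⟨g, hg, hgX, hgf⟩ := exists_extension_of_cone hv hvW hA hf hfX
  exact ⟨g, hg.continuousOn, fun z _ => hgX z, hgf⟩

/-- Maps that avoid the vertex `v` extend as soon as maps into the deletion of `v` do. -/
theorem exists_extension_of_avoids_vertex {W : Set ι} {v : ι} (hv : v ∉ W) {d : ℕ}
    (hW : ExtendsBelow Z d (indepRealization G W)) {S A : Set Z} (hS : IsClosed S)
    (hSd : DimLT d S) (hA : IsClosed A) (hAS : A ⊆ S) {f : Z → ι → ℝ} (hf : ContinuousOn f A)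
    (hfX : Set.MapsTo f A (indepRealization G (insert v W)))
    (hne : ∀ z ∈ A, ∃ i, i ≠ v ∧ f z i ≠ 0) :
    ∃ g : Z → ι → ℝ, ContinuousOn g S ∧ Set.MapsTo g S (indepRealization G (insert v W)) ∧
      Set.EqOn g f A := by
  classical
  obtain ⟨y, hy, hyX, hyf⟩ := hW S A hS hSd hA hAS (fun z => Function.update (f z) v 0)
    (fun z hz => (hf z hz).update v tendsto_const_nhds) (by
      intro z hz
      obtain ⟨h0, hins, hind, -⟩ := hfX hz
      refine ⟨fun i => ?_, fun i hi => ?_, fun i j hij => ?_, ?_⟩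
      · rcases eq_or_ne i v with rfl | hiv
        · simp
        · simpa [hiv] using h0 i
      · rcases eq_or_ne i v with rfl | hiv
        · simp at hi
        · exact (hins i (by simpa [hiv] using hi)).resolve_left hiv
      · rcases eq_or_ne i v with rfl | hiv
        · simp
        rcases eq_or_ne j v with rfl | hjv
        · simp
        simpa [hiv, hjv] using hind i j hij
      · obtain ⟨i, hiv, hi⟩ := hne z hz
        exact ⟨i, by simpa [hiv] using hi⟩)
  obtain ⟨k, hk, hkf⟩ := exists_continuous_eqOn hA hf
  let c : Z → ℝ := fun z => ∑ j, if G.Adj v j then y z j else 0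
  let s : Z → ℝ := fun z => ∑ j, y z j
  have hyc : ∀ j, ContinuousOn (fun z => y z j) S := fun j =>
    (continuous_apply j).comp_continuousOn hy
  have hc : ContinuousOn c S := by
    refine continuousOn_finsetSum _ fun j _ => ?_
    split_ifs
    exacts [hyc j, continuousOn_const]
  have hs : ContinuousOn s S := continuousOn_finsetSum _ fun j _ => hyc j
  have hspos : ∀ z ∈ S, 0 < s z := by
    intro z hz
    obtain ⟨i, hi⟩ := (hyX hz).2.2.2
    exact Finset.sum_pos' (fun j _ => (hyX hz).1 j)
      ⟨i, Finset.mem_univ i, lt_of_le_of_ne ((hyX hz).1 i) (Ne.symm hi)⟩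
  have hcs : ∀ z ∈ S, c z ≤ s z := by
    intro z hz
    refine Finset.sum_le_sum fun j _ => ?_
    split_ifs
    exacts [le_rfl, (hyX hz).1 j]
  let l : Z → ι → ℝ := fun z => Function.update (y z) v (|k z v| * ((s z - c z) / s z))
  have hl : ContinuousOn l S := by
    have hlv : ContinuousOn (fun z => |k z v| * ((s z - c z) / s z)) S :=
      (((continuous_apply v).comp hk).abs).continuousOn.mul
        ((hs.sub hc).div hs fun z hz => (hspos z hz).ne')
    exact fun z hz => (hy z hz).update v (hlv z hz)
  have hl0 : ∀ z ∈ S, ∀ i, 0 ≤ l z i := by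
    intro z hz i
    rcases eq_or_ne i v with rfl | hiv
    · simp only [l, Function.update_self]
      exact mul_nonneg (abs_nonneg _) (div_nonneg (sub_nonneg.2 (hcs z hz)) (hspos z hz).le)
    · simpa [l, hiv] using (hyX hz).1 i
  have hlf : ∀ z ∈ A, l z = f z := by
    intro z hz
    funext i
    rcases eq_or_ne i v with rfl | hiv
    · simp only [l, Function.update_self, hkf hz, abs_of_nonneg ((hfX hz).1 i)]
      by_cases hi : f z i = 0
      · rw [hi, zero_mul]
      · have hcz : c z = 0 := by
          refine Finset.sum_eq_zero fun j _ => ?_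
          split_ifs with hij
          · rw [hyf hz]
            simpa [hij.ne'] using ((hfX hz).2.2.1 i j hij).resolve_left hi
          · rfl
        rw [hcz, sub_zero, div_self (hspos z (hAS hz)).ne', mul_one]
    · simp only [l, Function.update_of_ne hiv, hyf hz]
  refine ⟨fun z => indepRetraction G (l z), (continuous_indepRetraction G).comp_continuousOn hl,
    fun z hz => ?_, fun z hz => ?_⟩
  · refine indepRetraction_mem (hl0 z hz) (fun i hi => ?_) ?_
    · rcases eq_or_ne i v with rfl | hiv
      · exact Set.mem_insert i W
      · exact Or.inr ((hyX hz).2.1 i (by simpa [l, hiv] using hi))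
    · have hyv : y z v = 0 := by
        by_contra h
        exact hv ((hyX hz).2.1 v h)
      rcases (hcs z hz).eq_or_lt with heq | hlt
      · have hly : l z = y z := by
          simp only [l, heq, sub_self, zero_div, mul_zero]
          exact Function.update_eq_self_iff.2 hyv.symm
        obtain ⟨i, hi⟩ := (hyX hz).2.2.2
        rw [hly]
        exact ⟨i, hi, fun j hj => ((hyX hz).2.2.1 i j hj).resolve_left hi⟩
      · obtain ⟨i, -, hi⟩ := Finset.exists_lt_of_sum_lt hlt
        have hvi : ¬ G.Adj v i := fun h => by simp [h] at hi
        rw [if_neg hvi] at hi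
        have hiv : i ≠ v := by
          rintro rfl
          exact hi.ne' hyv
        refine ⟨i, by simpa [l, hiv] using hi.ne', fun j hj => ?_⟩
        have hjv : j ≠ v := by
          rintro rfl
          exact hvi hj.symm
        simpa [l, hjv] using ((hyX hz).2.2.1 i j hj).resolve_left hi.ne'
  · simp only [hlf z hz, indepRetraction_eq_self (hfX hz)]

/-- Attaching a vertex along its link. -/
theorem ExtendsBelow.insert_vertex {W : Set ι} {v : ι} (hv : v ∉ W) {d : ℕ}
    (hW : ExtendsBelow Z (d + 1) (indepRealization G W))
    (hL : ExtendsBelow Z d (indepRealization G {w ∈ W | ¬ G.Adj v w})) :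
    ExtendsBelow Z (d + 1) (indepRealization G (insert v W)) := by
  classical
  intro S A hS hSd hA hAS f hf hfX
  let y : Z → ι → ℝ := fun z => Function.update (f z) v 0
  have hy : ContinuousOn y A := fun z hz => (hf z hz).update v tendsto_const_nhds
  have hfv : ContinuousOn (fun z => f z v) A := (continuous_apply v).comp_continuousOn hf
  have hC : IsClosed {z ∈ A | y z = 0} := hy.preimage_isClosed_of_isClosed hA isClosed_singleton
  have hD : IsClosed {z ∈ A | f z v = 0} :=
    hfv.preimage_isClosed_of_isClosed hA isClosed_singleton
  have hCD : Disjoint {z ∈ A | y z = 0} {z ∈ A | f z v = 0} := by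
    refine Set.disjoint_left.2 fun z ⟨hz, hyz⟩ ⟨_, hvz⟩ => ?_
    obtain ⟨i, hi⟩ := (hfX hz).2.2.2
    rcases eq_or_ne i v with rfl | hiv
    · exact hi hvz
    · exact hi (by simpa [y, hiv] using congrFun hyz i)
  obtain ⟨U, V, hU, hV, hUV, hCU, hDV, hP⟩ :=
    hSd _ _ hC hD ((Set.sep_subset _ _).trans hAS) ((Set.sep_subset _ _).trans hAS) hCD
  set P := S \ (U ∪ V) with hPdef
  have hPc : IsClosed P := hS.sdiff (hU.union hV)
  have hyU : ∀ z ∈ A, z ∉ U → ∃ i, i ≠ v ∧ f z i ≠ 0 := by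
    intro z hz hzU
    by_contra! hcon
    refine hzU (hCU ⟨hz, funext fun i => ?_⟩)
    rcases eq_or_ne i v with rfl | hiv
    · simp [y]
    · simpa [y, hiv] using hcon i hiv
  have hfV : ∀ z ∈ A, z ∉ V → f z v ≠ 0 := fun z hz hzV h => hzV (hDV ⟨hz, h⟩)
  -- the map to the link on the separating set
  obtain ⟨h, hh, hhX, hhy⟩ := hL P (A ∩ P) hPc hP (hA.inter hPc) Set.inter_subset_right y
    (hy.mono Set.inter_subset_left) (by
      rintro z ⟨hz, -, hzUV⟩
      rw [Set.mem_union, not_or] at hzUV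
      obtain ⟨h0, hins, hind, -⟩ := hfX hz
      have hvz := hfV z hz hzUV.2
      refine ⟨fun i => ?_, fun i hi => ?_, fun i j hij => ?_, ?_⟩
      · rcases eq_or_ne i v with rfl | hiv
        · simp [y]
        · simpa [y, hiv] using h0 i
      · rcases eq_or_ne i v with rfl | hiv
        · simp [y] at hi
        · have hi' : f z i ≠ 0 := by simpa [y, hiv] using hi
          exact ⟨(hins i hi').resolve_left hiv, fun hvi => (hind v i hvi).elim hvz hi'⟩
      · rcases eq_or_ne i v with rfl | hiv
        · simp [y]
        rcases eq_or_ne j v with rfl | hjv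
        · simp [y]
        simpa [y, hiv, hjv] using hind i j hij
      · obtain ⟨i, hiv, hi⟩ := hyU z hz hzUV.1
        exact ⟨i, by simpa [y, hiv] using hi⟩)
  obtain ⟨k, hk, hkf⟩ := exists_continuous_eqOn hA hf
  let p : Z → ι → ℝ := fun z => Function.update (h z) v |k z v|
  have hp : ContinuousOn p P := fun z hz =>
    (hh z hz).update v (((continuous_apply v).comp hk).abs).continuousWithinAt
  have hstar : ∀ z ∈ P, p z ∈ indepRealization G (insert v {w ∈ W | ¬ G.Adj v w}) ∧
      ∃ i, i ≠ v ∧ p z i ≠ 0 := by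
    intro z hz
    obtain ⟨h0, hW', hind, i, hi⟩ := hhX hz
    have hne : ∀ i, h z i ≠ 0 → i ≠ v := by
      rintro i hi rfl
      exact hv (hW' i hi).1
    have hvadj : ∀ j, G.Adj v j → p z j = 0 := by
      intro j hj
      have : p z j = h z j := by simp [p, hj.ne']
      rw [this]
      by_contra hcon
      exact (hW' j hcon).2 hj
    have hpi : i ≠ v ∧ p z i ≠ 0 := ⟨hne i hi, by simpa [p, hne i hi] using hi⟩
    refine ⟨⟨fun j => ?_, fun j hj => ?_, fun a b hab => ?_, i, hpi.2⟩, i, hpi⟩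
    · rcases eq_or_ne j v with rfl | hjv
      · simp [p]
      · simpa [p, hjv] using h0 j
    · rcases eq_or_ne j v with rfl | hjv
      · exact Set.mem_insert _ _
      · exact Or.inr (hW' j (by simpa [p, hjv] using hj))
    · rcases eq_or_ne a v with rfl | hav
      · exact Or.inr (hvadj b hab)
      rcases eq_or_ne b v with rfl | hbv
      · exact Or.inl (hvadj a hab.symm)
      simpa [p, hav, hbv] using hind a b hab
  have hpf : Set.EqOn p f (A ∩ P) := by
    intro z hz
    funext i
    rcases eq_or_ne i v with rfl | hiv
    · simp [p, hkf hz.1, abs_of_nonneg ((hfX hz.1).1 i)]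
    · simp [p, hiv, hhy hz, y]
  let F : Z → ι → ℝ := fun z => if z ∈ A then f z else p z
  have hFA : Set.EqOn F f A := fun z hz => if_pos hz
  have hFP : Set.EqOn F p P := by
    intro z hz
    by_cases hzA : z ∈ A
    · rw [hFA hzA, hpf ⟨hzA, hz⟩]
    · exact if_neg hzA
  have hF : ContinuousOn F (A ∪ P) :=
    (hf.congr hFA).union_of_isClosed (hp.congr hFP) hA hPc
  have hstar_sub : indepRealization G (insert v {w ∈ W | ¬ G.Adj v w}) ⊆
      indepRealization G (insert v W) := fun x hx =>
    ⟨hx.1, fun i hi => (hx.2.1 i hi).imp id And.left, hx.2.2⟩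
  have hAPS : A ∪ P ⊆ S := Set.union_subset hAS Set.sdiff_subset
  obtain ⟨g₁, hg₁, hg₁X, hg₁F⟩ := exists_extension_of_cone (G := G)
    (Set.mem_insert v {w ∈ W | ¬ G.Adj v w})
    (by
      rintro w (rfl | hw)
      exacts [G.irrefl, hw.2])
    ((hA.union hPc).sdiff hV) (hF.mono Set.sdiff_subset) (by
      rintro z ⟨hz, hzV⟩
      by_cases hzA : z ∈ A
      · rw [hFA hzA]
        obtain ⟨h0, hins, hind, hne⟩ := hfX hzA
        refine ⟨h0, fun i hi => (hins i hi).imp id fun hiW => ⟨hiW, fun hvi => ?_⟩, hind, hne⟩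
        exact (hind v i hvi).elim (hfV z hzA hzV) hi
      · have hzP := hz.resolve_left hzA
        rw [hFP hzP]
        exact (hstar z hzP).1)
  obtain ⟨g₂, hg₂, hg₂X, hg₂F⟩ := exists_extension_of_avoids_vertex hv hW (S := S \ U)
    (A := (A ∪ P) \ U) (hS.sdiff hU) (hSd.mono Set.sdiff_subset) ((hA.union hPc).sdiff hU)
    (Set.sdiff_subset_sdiff_left hAPS) (hF.mono Set.sdiff_subset) (by
      rintro z ⟨hz, -⟩
      by_cases hzA : z ∈ A
      · rw [hFA hzA]
        exact hfX hzA
      · have hzP := hz.resolve_left hzA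
        rw [hFP hzP]
        exact hstar_sub (hstar z hzP).1) (by
      rintro z ⟨hz, hzU⟩
      by_cases hzA : z ∈ A
      · rw [hFA hzA]
        exact hyU z hzA hzU
      · have hzP := hz.resolve_left hzA
        rw [hFP hzP]
        exact (hstar z hzP).2)
  let g : Z → ι → ℝ := fun z => if z ∈ V then g₂ z else g₁ z
  have hg1 : Set.EqOn g g₁ (S \ V) := fun z hz => if_neg hz.2
  have hg2 : Set.EqOn g g₂ (S \ U) := by
    intro z hz
    by_cases hzV : z ∈ V
    · exact if_pos hzV
    · have hzP : z ∈ P := ⟨hz.1, fun h => h.elim hz.2 hzV⟩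
      rw [hg1 ⟨hz.1, hzV⟩, hg₁F ⟨Or.inr hzP, hzV⟩, hg₂F ⟨Or.inr hzP, hz.2⟩]
  have hcover : ∀ z ∈ S, z ∈ S \ V ∪ S \ U := by
    intro z hz
    by_cases hzV : z ∈ V
    · exact Or.inr ⟨hz, fun hzU => Set.disjoint_left.1 hUV hzU hzV⟩
    · exact Or.inl ⟨hz, hzV⟩
  refine ⟨g, ?_, fun z hz => ?_, fun z hz => ?_⟩
  · exact ((hg₁.continuousOn.congr hg1).union_of_isClosed (hg₂.congr hg2) (hS.sdiff hV)
      (hS.sdiff hU)).mono hcover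
  · rcases hcover z hz with hz' | hz'
    · rw [hg1 hz']
      exact hstar_sub (hg₁X z)
    · rw [hg2 hz']
      exact hg₂X hz'
  · rcases hcover z (hAS hz) with hz' | hz'
    · rw [hg1 hz', hg₁F ⟨Or.inl hz, hz'.2⟩, hFA hz]
    · rw [hg2 hz', hg₂F ⟨Or.inl hz, hz'.2⟩, hFA hz]

/-- Attaching pairwise adjacent vertices along their links. -/
theorem ExtendsBelow.union_clique {W : Set ι} (I : Finset ι) (hI : ∀ i ∈ I, i ∉ W)
    (hclique : G.IsClique I) {d : ℕ} (hW : ExtendsBelow Z (d + 1) (indepRealization G W))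
    (hL : ∀ v ∈ I, ExtendsBelow Z d (indepRealization G {w ∈ W | ¬ G.Adj v w})) :
    ExtendsBelow Z (d + 1) (indepRealization G (W ∪ I)) := by
  classical
  induction I using Finset.induction_on with
  | empty => simpa using hW
  | insert v I hvI ih =>
    rw [Finset.coe_insert, Set.union_insert]
    have hIv : ∀ i ∈ I, G.Adj v i := fun i hi =>
      hclique (by simp) (by simp [hi]) (by rintro rfl; exact hvI hi)
    refine ExtendsBelow.insert_vertex ?_ (ih (fun i hi => hI i (Finset.mem_insert_of_mem hi))
      (hclique.subset (by simp)) fun i hi => hL i (Finset.mem_insert_of_mem hi)) ?_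
    · rintro (h | h)
      · exact hI v (Finset.mem_insert_self v I) h
      · exact hvI h
    · have : {w ∈ W ∪ (I : Set ι) | ¬ G.Adj v w} = {w ∈ W | ¬ G.Adj v w} := by
        ext w
        constructor
        · rintro ⟨hw | hw, hadj⟩
          · exact ⟨hw, hadj⟩
          · exact absurd (hIv w hw) hadj
        · rintro ⟨hw, hadj⟩
          exact ⟨Or.inl hw, hadj⟩
      rw [this]
      exact hL v (Finset.mem_insert_self v I)

end IndependenceComplex

section Chessboard

/-- The graph on the squares of a board joining distinct squares in a common row or column. -/
def rookGraph (α β : Type*) : SimpleGraph (α × β) where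
  Adj p q := p ≠ q ∧ (p.1 = q.1 ∨ p.2 = q.2)
  symm := ⟨fun _ _ h => ⟨h.1.symm, h.2.imp Eq.symm Eq.symm⟩⟩
  loopless := ⟨fun _ h => h.1 rfl⟩

theorem extendsBelow_chessboard {Z : Type*} [MetricSpace Z] {α β : Type*} [Fintype α] [Fintype β]
    [DecidableEq α] [DecidableEq β] (m : ℕ) (R : Finset α) (C : Finset β) (hR : R.card = m)
    (hC : 2 * m ≤ C.card + 1) :
    ExtendsBelow Z m
      (indepRealization (rookGraph α β) ((R ×ˢ C : Finset (α × β)) : Set (α × β))) := by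
  induction m generalizing R C with
  | zero =>
    intro S A _ hSd _ hAS f _ _
    obtain rfl : S = ∅ := hSd
    exact ⟨f, continuousOn_empty f, Set.mapsTo_empty f _, fun z _ => rfl⟩
  | succ m ih =>
    obtain ⟨a, ha⟩ : R.Nonempty := Finset.card_pos.1 (by omega)
    obtain ⟨c, hc⟩ : C.Nonempty := Finset.card_pos.1 (by omega)
    have hcone : ExtendsBelow Z (m + 1) (indepRealization (rookGraph α β)
        (insert (a, c) ((R.erase a ×ˢ C.erase c : Finset (α × β)) : Set (α × β)))) := by
      refine extendsBelow_of_cone (Set.mem_insert _ _) ?_ _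
      rintro ⟨b, t⟩ (h | h) hadj
      · exact hadj.1 h.symm
      · simp [rookGraph] at h hadj
        tauto
    have hrow := hcone.union_clique (({a} : Finset α) ×ˢ C.erase c)
      (by
        rintro ⟨b, t⟩ h
        simp at h ⊢
        tauto)
      (by
        rintro ⟨b, t⟩ h ⟨b', t'⟩ h' hne
        simp at h h'
        exact ⟨hne, Or.inl (h.1.2.symm.trans h'.1.2)⟩)
      (by
        rintro ⟨b, t⟩ h
        simp at h
        have hset : {w ∈ insert (a, c) ((R.erase a ×ˢ C.erase c : Finset (α × β)) : Set (α × β)) |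
            ¬ (rookGraph α β).Adj (b, t) w} =
            ((R.erase a ×ˢ (C.erase c).erase t : Finset (α × β)) : Set (α × β)) := by
          ext ⟨b', t'⟩
          simp [rookGraph]
          grind
        rw [hset]
        refine ih _ _ (by rw [Finset.card_erase_of_mem ha]; omega) ?_
        rw [Finset.card_erase_of_mem (by simp; tauto), Finset.card_erase_of_mem hc]
        omega)
    have hcol := hrow.union_clique (R.erase a ×ˢ ({c} : Finset β))
      (by
        rintro ⟨b, t⟩ h
        simp at h ⊢
        tauto)
      (by
        rintro ⟨b, t⟩ h ⟨b', t'⟩ h' hne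
        simp at h h'
        exact ⟨hne, Or.inr (h.1.2.symm.trans h'.1.2)⟩)
      (by
        rintro ⟨b, t⟩ h
        simp at h
        have hset : {w ∈ insert (a, c) ((R.erase a ×ˢ C.erase c : Finset (α × β)) : Set (α × β)) ∪
            ((({a} : Finset α) ×ˢ C.erase c : Finset (α × β)) : Set (α × β)) |
            ¬ (rookGraph α β).Adj (b, t) w} =
            ((R.erase b ×ˢ C.erase c : Finset (α × β)) : Set (α × β)) := by
          ext ⟨b', t'⟩
          simp [rookGraph]
          grind
        rw [hset]
        refine ih _ _ (by rw [Finset.card_erase_of_mem (by tauto)]; omega) ?_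
        rw [Finset.card_erase_of_mem hc]
        omega)
    convert hcol using 2
    ext ⟨b, t⟩
    simp
    grind

end Chessboard

section Extension

open unitInterval Topology

theorem ExtendsBelow.of_retract {Z Y Y' : Type*} [TopologicalSpace Z] [TopologicalSpace Y]
    [TopologicalSpace Y'] {d : ℕ} {X : Set Y} {X' : Set Y'} (h : ExtendsBelow Z d X) {s : Y' → Y}
    {p : Y → Y'} (hs : ContinuousOn s X') (hsX : Set.MapsTo s X' X) (hp : ContinuousOn p X)
    (hpX : Set.MapsTo p X X') (hps : ∀ x ∈ X', p (s x) = x) : ExtendsBelow Z d X' := by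
  intro S A hS hSd hA hAS f hf hfX
  obtain ⟨g, hg, hgX, hgf⟩ := h S A hS hSd hA hAS (s ∘ f) (hs.comp hf hfX) (hsX.comp hfX)
  exact ⟨p ∘ g, hp.comp hg hgX, hpX.comp hgX, fun z hz => by
    rw [Function.comp_apply, hgf hz, Function.comp_apply, hps _ (hfX hz)]⟩

/-- Two maps from a cube agreeing on the boundary are homotopic relative to it, provided maps into
the target extend over sets of one dimension more. -/
theorem ExtendsBelow.homotopicRel {N : Type*} [Fintype N] {Y : Type*} [TopologicalSpace Y]
    {X : Set Y} {d : ℕ} (h : ExtendsBelow (Option N → ℝ) d X) (hd : Fintype.card N + 1 < d)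
    (f g : C(I^N, X)) (hfg : ∀ y ∈ Cube.boundary N, f y = g y) :
    f.HomotopicRel g (Cube.boundary N) := by
  classical
  let S : Set (Option N → ℝ) := Set.Icc 0 1
  have hS : IsCompact S := isCompact_Icc
  let q : (Option N → ℝ) → I^N := fun z i => Set.projIcc 0 1 zero_le_one (z (some i))
  have hq : Continuous q :=
    continuous_pi fun i => continuous_projIcc.comp (continuous_apply (some i))
  let A₀ : Set (Option N → ℝ) :=
    S ∩ ({z | z none = 0} ∪ ⋃ i : N, {z | z (some i) = 0 ∨ z (some i) = 1})
  let A₁ : Set (Option N → ℝ) := S ∩ {z | z none = 1}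
  have hA₀ : IsClosed A₀ := by
    refine hS.isClosed.inter ((isClosed_eq (continuous_apply _) continuous_const).union
      (isClosed_iUnion_of_finite fun i => ?_))
    exact (isClosed_eq (continuous_apply _) continuous_const).union
      (isClosed_eq (continuous_apply _) continuous_const)
  have hA₁ : IsClosed A₁ :=
    hS.isClosed.inter (isClosed_eq (continuous_apply _) continuous_const)
  let F : (Option N → ℝ) → Y := fun z => if z none = 1 then g (q z) else f (q z)
  have hF₁ : Set.EqOn F (fun z => (g (q z) : Y)) A₁ := fun z hz => if_pos hz.2
  have hF₀ : Set.EqOn F (fun z => (f (q z) : Y)) A₀ := by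
    rintro z ⟨-, hz⟩
    by_cases h1 : z none = 1
    · have hb : q z ∈ Cube.boundary N := by
        rcases hz with hz | hz
        · exact absurd (h1.symm.trans hz) one_ne_zero
        · obtain ⟨i, hi⟩ := Set.mem_iUnion.1 hz
          refine ⟨i, hi.imp (fun hi => ?_) fun hi => ?_⟩ <;> ext <;> simp [q, hi]
      simp only [F, h1, if_true, hfg _ hb]
    · exact if_neg h1
  obtain ⟨G, hG, hGX, hGF⟩ := h S (A₀ ∪ A₁) hS.isClosed (hS.dimLT (by simpa using hd))
    (hA₀.union hA₁) (Set.union_subset Set.inter_subset_left Set.inter_subset_left) F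
    (((continuous_subtype_val.comp (f.continuous.comp hq)).continuousOn.congr hF₀).union_of_isClosed
      ((continuous_subtype_val.comp (g.continuous.comp hq)).continuousOn.congr hF₁) hA₀ hA₁)
    (fun z _ => by
      simp only [F]
      split_ifs
      exacts [(g (q z)).2, (f (q z)).2])
  let e : I × (I^N) → Option N → ℝ := fun p o => o.elim (p.1 : ℝ) fun i => (p.2 i : ℝ)
  have he : Continuous e := by
    refine continuous_pi fun o => ?_
    cases o <;> simp only [e, Option.elim] <;> fun_prop
  have heS : ∀ p, e p ∈ S := by
    intro p
    refine ⟨fun o => ?_, fun o => ?_⟩ <;> cases o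
    exacts [p.1.2.1, (p.2 _).2.1, p.1.2.2, (p.2 _).2.2]
  have hqe : ∀ p, q (e p) = p.2 := fun p => funext fun i => Set.projIcc_val _ _
  have hH₀ : ∀ p, e p ∈ A₀ → G (e p) = f p.2 := fun p hp => by
    simp only [hGF (Or.inl hp), hF₀ hp, hqe]
  have hH₁ : ∀ p, e p ∈ A₁ → G (e p) = g p.2 := fun p hp => by
    simp only [hGF (Or.inr hp), hF₁ hp, hqe]
  refine ⟨{ toFun := fun p => ⟨G (e p), hGX (heS p)⟩
            continuous_toFun := (hG.comp_continuous he heS).subtype_mk _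
            map_zero_left := fun y => Subtype.ext (hH₀ (0, y) ⟨heS _, Or.inl rfl⟩)
            map_one_left := fun y => Subtype.ext (hH₁ (1, y) ⟨heS _, rfl⟩)
            prop' := fun t y hy => Subtype.ext (hH₀ (t, y) ⟨heS _, Or.inr ?_⟩) }⟩
  obtain ⟨i, hi⟩ := hy
  exact Set.mem_iUnion.2 ⟨i, by simpa [e] using hi⟩

theorem ExtendsBelow.subsingleton_homotopyGroup {N : Type*} [Fintype N] {Y : Type*}
    [TopologicalSpace Y] {X : Set Y} {d : ℕ} (h : ExtendsBelow (Option N → ℝ) d X)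
    (hd : Fintype.card N + 1 < d) (x : X) : Subsingleton (HomotopyGroup N X x) := by
  refine ⟨fun a b => ?_⟩
  induction a using Quotient.inductionOn
  induction b using Quotient.inductionOn
  rename_i f g
  exact Quotient.sound (h.homotopicRel hd f.1 g.1 fun y hy => (f.2 y hy).trans (g.2 y hy).symm)

theorem ExtendsBelow.joined {Y : Type*} [TopologicalSpace Y] {X : Set Y} {d : ℕ}
    (h : ExtendsBelow (Option Empty → ℝ) d X) (hd : 1 < d) (x y : X) : Joined x y := by
  obtain ⟨H⟩ := h.homotopicRel (by simpa using hd) (ContinuousMap.const _ x)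
    (ContinuousMap.const _ y) fun _ hz => hz.elim fun i => i.elim
  exact ⟨H.evalAt isEmptyElim⟩

end Extension

theorem ConfC2.extendsBelow {Z : Type*} [MetricSpace Z] (r : ℕ) :
    ExtendsBelow Z r (ConfC2 r) := by
  have key := extendsBelow_chessboard (Z := Z) r (Finset.univ : Finset (Fin r))
    (Finset.univ : Finset (Fin (2 * r - 1))) (by simp) (by simp; omega)
  have hpos : ∀ x ∈ indepRealization (rookGraph (Fin r) (Fin (2 * r - 1)))
      ((Finset.univ ×ˢ Finset.univ : Finset (Fin r × Fin (2 * r - 1))) : Set _),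
      0 < ∑ i, x i := by
    rintro x ⟨h0, -, -, i, hi⟩
    exact Finset.sum_pos' (fun j _ => h0 j)
      ⟨i, Finset.mem_univ i, lt_of_le_of_ne (h0 i) (Ne.symm hi)⟩
  refine key.of_retract (s := fun M i => M i.1 i.2) (p := fun x b t => x (b, t) / ∑ i, x i)
    (by fun_prop) ?_ ?_ ?_ ?_
  · rintro M ⟨h0, hsum, hrow, hcol⟩
    refine ⟨fun i => h0 _ _, fun i _ => by simp, ?_, ?_⟩
    · rintro ⟨b, t⟩ ⟨b', t'⟩ ⟨hne, h⟩
      by_contra! hcon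
      obtain rfl | rfl : b = b' ∨ t = t' := h
      · exact hne (by rw [hrow b t t' hcon.1 hcon.2])
      · exact hne (by rw [hcol t b b' hcon.1 hcon.2])
    · by_contra! hcon
      refine zero_ne_one (hsum.symm.trans ?_).symm
      exact Finset.sum_eq_zero fun b _ => Finset.sum_eq_zero fun t _ => hcon (b, t)
  · refine continuousOn_pi.2 fun b => continuousOn_pi.2 fun t => ?_
    exact (continuous_apply (b, t)).continuousOn.div
      (continuous_finsetSum _ fun i _ => continuous_apply i).continuousOn
      fun x hx => (hpos x hx).ne'
  · intro x hx
    have hx' := hpos x hx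
    obtain ⟨h0, -, hind, -⟩ := hx
    have hnz : ∀ i, x i / ∑ i, x i ≠ 0 → x i ≠ 0 := fun i hi h => hi (by rw [h, zero_div])
    refine ⟨fun b t => div_nonneg (h0 _) hx'.le, ?_, fun b t t' h h' => ?_, fun t b b' h h' => ?_⟩
    · simp_rw [← Finset.sum_div]
      rw [← Fintype.sum_prod_type', div_self hx'.ne']
    · by_contra hne
      exact (hind (b, t) (b, t') ⟨by simpa using hne, Or.inl rfl⟩).elim (hnz _ h) (hnz _ h')
    · by_contra hne
      exact (hind (b, t) (b', t) ⟨by simpa using hne, Or.inr rfl⟩).elim (hnz _ h) (hnz _ h')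
  · rintro M ⟨-, hsum, -⟩
    funext b t
    simp only [Fintype.sum_prod_type, hsum, div_one]

theorem ConfC2.nonempty {r : ℕ} (hr : 1 ≤ r) : (ConfC2 r).Nonempty := by
  obtain ⟨g, -, hg, -⟩ := ConfC2.extendsBelow (Z := Empty → ℝ) r Set.univ ∅ isClosed_univ
    (isCompact_univ.dimLT (by rw [Fintype.card_eq_zero]; omega)) isClosed_empty (Set.empty_subset _) 0
    (continuousOn_empty _) (Set.mapsTo_empty _ _)
  exact ⟨g 0, hg (Set.mem_univ 0)⟩

/-- The chessboard complex `Δ_{r,2r-1}` is `(r-2)`-connected: it is nonempty,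
path-connected, and its homotopy groups `πₙ` vanish for `1 ≤ n ≤ r - 2`. -/
theorem chessboard_connectivity (r : ℕ) (hr : 2 ≤ r) :
    (ConfC2 r).Nonempty ∧ PathConnectedSpace (ConfC2 r) ∧
      ∀ n : ℕ, 1 ≤ n → n ≤ r - 2 → ∀ x : ConfC2 r,
        Subsingleton (HomotopyGroup (Fin n) (ConfC2 r) x) := by
  have hne : (ConfC2 r).Nonempty := ConfC2.nonempty (by omega)
  refine ⟨hne, ⟨hne.to_subtype, (ConfC2.extendsBelow r).joined (by omega)⟩, fun n hn hnr x => ?_⟩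
  exact (ConfC2.extendsBelow r).subsingleton_homotopyGroup (by rw [Fintype.card_fin]; omega) x
end

section
/- (Test-map construction: no envy-free division yields an equivariant diagonal-avoiding map.) Let r ≥ 2 and let B : Fin r → Fin r → Set C₁ be a new-style preference matrix on C₁ that is closed, covering, and equivariant. Suppose that for every permutation σ ∈ Equiv.Perm (Fin r), the intersection ⋂ j, B (σ j) j is empty. Then there exists a continuous S_r-equivariant map F : C₁ → (Fin r → ℝ) such that for every M ∈ C₁, all coordinates of F(M) are nonnegative, ∑ i, F(M) i = 1, and F(M) ≠ (fun i => 1/r) (i.e., F takes values in the standard simplex and misses its barycenter). Here S_r acts on Fin r → ℝ by permuting coordinates ((σ·y) i = y (σ⁻¹ i)), and equivariance means F(σ·M) = σ·F(M). -/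
/-- The configuration space `C₁`, the geometric realization of the chessboard
complex `Δ_{r,r-1} * [r]`: matrices with nonnegative entries summing to `1`,
at most one nonzero entry in each column, and at most one nonzero entry in
each row among the columns other than the last one. -/
def ConfC1 (r : ℕ) : Set (Fin r → Fin r → ℝ) :=
  {M | (∀ b t, 0 ≤ M b t) ∧ (∑ b, ∑ t, M b t) = 1 ∧
    (∀ t b b', M b t ≠ 0 → M b' t ≠ 0 → b = b') ∧
    (∀ (b : Fin r) (t t' : Fin r), (t : ℕ) + 1 < r → (t' : ℕ) + 1 < r →
      M b t ≠ 0 → M b t' ≠ 0 → t = t')}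

/-- The action of `σ ∈ S_r` on configuration spaces of matrices,
permuting the rows (boxes). -/
def rowPerm {r m : ℕ} (σ : Equiv.Perm (Fin r)) (M : Fin r → Fin m → ℝ) :
    Fin r → Fin m → ℝ :=
  fun b t => M (σ⁻¹ b) t

lemma rowPerm_isometry {r m : ℕ} (σ : Equiv.Perm (Fin r)) :
    Isometry (rowPerm σ : (Fin r → Fin m → ℝ) → (Fin r → Fin m → ℝ)) := by
  refine Isometry.of_dist_eq fun x y => le_antisymm ?_ ?_
  · exact (dist_pi_le_iff dist_nonneg).2 fun b => dist_le_pi_dist x y (σ⁻¹ b)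
  · refine (dist_pi_le_iff dist_nonneg).2 fun b => ?_
    have hrow : ∀ z : Fin r → Fin m → ℝ, rowPerm σ z (σ b) = z b := fun z => by
      funext t
      simp [rowPerm]
    simpa only [hrow] using dist_le_pi_dist (rowPerm σ x) (rowPerm σ y) (σ b)

lemma rowPerm_mul {r m : ℕ} (σ τ : Equiv.Perm (Fin r)) (M : Fin r → Fin m → ℝ) :
    rowPerm σ (rowPerm τ M) = rowPerm (σ * τ) M := by
  funext b t
  simp [rowPerm]

lemma rowPerm_one {r m : ℕ} (M : Fin r → Fin m → ℝ) : rowPerm 1 M = M := rfl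

/-- A doubly stochastic matrix has a positive generalized diagonal. -/
lemma exists_perm_pos_of_mem_doublyStochastic {n : Type*} [Fintype n] [DecidableEq n]
    {A : Matrix n n ℝ} (hA : A ∈ doublyStochastic ℝ n) :
    ∃ σ : Equiv.Perm n, ∀ j, 0 < A (σ j) j := by
  obtain ⟨w, hw0, hw1, hw⟩ := exists_eq_sum_perm_of_mem_doublyStochastic hA
  obtain ⟨σ, -, hσ⟩ : ∃ σ ∈ Finset.univ, (0 : ℝ) < w σ := by
    by_contra! h
    have := Finset.sum_nonpos h
    linarith
  refine ⟨σ⁻¹, fun j => ?_⟩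
  rw [← hw, Matrix.sum_apply]
  refine Finset.sum_pos' (fun τ _ => ?_) ⟨σ, Finset.mem_univ _, ?_⟩
  · simp only [Matrix.smul_apply, smul_eq_mul, Equiv.Perm.permMatrix, PEquiv.toMatrix_apply]
    exact mul_nonneg (hw0 τ) (by split_ifs <;> norm_num)
  · simpa [Equiv.Perm.permMatrix, PEquiv.toMatrix_apply] using hσ

/-- The smallest total distance from `M` to the sets `B (σ j) j`, over all permutations `σ`. -/
noncomputable def minTransversalDist {X ι : Type*} [PseudoMetricSpace X] [Fintype ι]
    [DecidableEq ι] (B : ι → ι → Set X) (x : X) : ℝ :=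
  Finset.univ.inf' Finset.univ_nonempty
    fun σ : Equiv.Perm ι => ∑ j, Metric.infDist x (B (σ j) j)

/-- Unnormalized weight of the set `B i j` at `x`, vanishing once `x` is far from `B i j`. -/
noncomputable def bumpWeight {X ι : Type*} [PseudoMetricSpace X] [Fintype ι]
    [DecidableEq ι] (B : ι → ι → Set X) (i j : ι) (x : X) : ℝ :=
  max 0 (minTransversalDist B x / Fintype.card ι - Metric.infDist x (B i j))

section

variable {X ι : Type*} [PseudoMetricSpace X] [Fintype ι] [DecidableEq ι] (B : ι → ι → Set X)

lemma continuous_minTransversalDist : Continuous (minTransversalDist B) :=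
  Continuous.finset_inf'_apply _ fun _ _ =>
    continuous_finsetSum _ fun _ _ => Metric.continuous_infDist_pt _

lemma continuous_bumpWeight (i j : ι) : Continuous (bumpWeight B i j) :=
  continuous_const.max
    (((continuous_minTransversalDist B).div_const _).sub (Metric.continuous_infDist_pt _))

lemma bumpWeight_nonneg (i j : ι) (x : X) : 0 ≤ bumpWeight B i j x := le_max_left _ _

lemma minTransversalDist_eq_of_infDist_eq {B : ι → ι → Set X} {x y : X} (σ : Equiv.Perm ι)
    (h : ∀ i j, Metric.infDist y (B (σ i) j) = Metric.infDist x (B i j)) :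
    minTransversalDist B y = minTransversalDist B x := by
  simp only [minTransversalDist, Finset.inf'_univ_eq_ciInf]
  refine ((Equiv.mulLeft σ).iInf_congr fun τ => ?_).symm
  simp [h]

lemma bumpWeight_eq_of_infDist_eq {B : ι → ι → Set X} {x y : X} (σ : Equiv.Perm ι)
    (h : ∀ i j, Metric.infDist y (B (σ i) j) = Metric.infDist x (B i j)) (i j : ι) :
    bumpWeight B (σ i) j y = bumpWeight B i j x := by
  simp only [bumpWeight, h, minTransversalDist_eq_of_infDist_eq σ h]

lemma exists_bumpWeight_eq_zero [Nonempty ι] (σ : Equiv.Perm ι) (x : X) :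
    ∃ j, bumpWeight B (σ j) j x = 0 := by
  by_contra! h
  have hlt : ∀ j, Metric.infDist x (B (σ j) j) < minTransversalDist B x / Fintype.card ι := by
    intro j
    by_contra! hle
    exact h j (max_eq_left (by linarith))
  have hsum : ∑ j, Metric.infDist x (B (σ j) j) < minTransversalDist B x := by
    refine (Finset.sum_lt_sum_of_nonempty Finset.univ_nonempty fun j _ => hlt j).trans_eq ?_
    rw [Finset.sum_const, Finset.card_univ, nsmul_eq_mul]
    field_simp
  exact hsum.not_ge (Finset.inf'_le _ (Finset.mem_univ σ))

end

/-- Test-map construction: if closed covering equivariant new-style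
preferences on `C₁` admit no envy-free division (for any permutation), then
there is a continuous `S_r`-equivariant map `F : C₁ → ℝ^r` taking values in
the standard simplex and missing its barycenter. -/
theorem test_map_construction (r : ℕ) (hr : 2 ≤ r)
    (B : Fin r → Fin r → Set (Fin r → Fin r → ℝ))
    (hsub : ∀ i j, B i j ⊆ ConfC1 r)
    (hclosed : ∀ i j, IsClosed {x : ConfC1 r | (x : Fin r → Fin r → ℝ) ∈ B i j})
    (hcov : ∀ j, ∀ M ∈ ConfC1 r, ∃ i, M ∈ B i j)
    (hequi : ∀ (σ : Equiv.Perm (Fin r)) (i j : Fin r), ∀ M ∈ ConfC1 r,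
      (M ∈ B i j ↔ rowPerm σ M ∈ B (σ i) j))
    (hempty : ∀ σ : Equiv.Perm (Fin r), (⋂ j, B (σ j) j) = ∅) :
    ∃ F : (Fin r → Fin r → ℝ) → (Fin r → ℝ),
      ContinuousOn F (ConfC1 r) ∧
      (∀ (σ : Equiv.Perm (Fin r)), ∀ M ∈ ConfC1 r,
        F (rowPerm σ M) = fun i => F M (σ⁻¹ i)) ∧
      (∀ M ∈ ConfC1 r, (∀ i, 0 ≤ F M i) ∧ (∑ i, F M i) = 1 ∧
        F M ≠ fun _ => 1 / (r : ℝ)) := by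
  have hr0 : (r : ℝ) ≠ 0 := by positivity
  have : Nonempty (Fin r) := ⟨⟨0, by omega⟩⟩
  have himage : ∀ (σ : Equiv.Perm (Fin r)) i j, rowPerm σ '' B i j = B (σ i) j := by
    intro σ i j
    ext N
    constructor
    · rintro ⟨M, hM, rfl⟩
      exact (hequi σ i j M (hsub i j hM)).1 hM
    · intro hN
      refine ⟨rowPerm σ⁻¹ N, ?_, by rw [rowPerm_mul, mul_inv_cancel, rowPerm_one]⟩
      simpa using (hequi σ⁻¹ (σ i) j N (hsub _ j hN)).1 hN
  have hdist : ∀ (σ : Equiv.Perm (Fin r)) M i j,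
      Metric.infDist (rowPerm σ M) (B (σ i) j) = Metric.infDist M (B i j) := by
    intro σ M i j
    rw [← himage, Metric.infDist_image (rowPerm_isometry σ)]
  have hmem : ∀ i j, ∀ M ∈ ConfC1 r, Metric.infDist M (B i j) = 0 → M ∈ B i j := by
    intro i j M hM h0
    have hne : (B i j).Nonempty := by
      obtain ⟨k, hk⟩ := hcov j M hM
      refine ⟨rowPerm (Equiv.swap k i) M, ?_⟩
      simpa using (hequi (Equiv.swap k i) k j M hM).1 hk
    have hcl : M ∈ closure (B i j) := (Metric.mem_closure_iff_infDist_zero hne).2 h0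
    have h := (hclosed i j).closure_subset
    have hx : (⟨M, hM⟩ : ConfC1 r) ∈ closure {x : ConfC1 r | (x : Fin r → Fin r → ℝ) ∈ B i j} := by
      rw [closure_subtype]
      convert hcl
      ext N
      simpa using fun hN => hsub i j hN
    exact h hx
  have hpos : ∀ M ∈ ConfC1 r, 0 < minTransversalDist B M := by
    intro M hM
    refine (Finset.lt_inf'_iff _).2 fun σ _ => ?_
    refine (Finset.sum_nonneg fun j _ => Metric.infDist_nonneg).lt_of_ne' fun h0 => ?_
    rw [Finset.sum_eq_zero_iff_of_nonneg fun j _ => Metric.infDist_nonneg] at h0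
    have hin : M ∈ ⋂ j, B (σ j) j :=
      Set.mem_iInter.2 fun j => hmem _ _ M hM (h0 j (Finset.mem_univ j))
    simp [hempty σ] at hin
  have hsum : ∀ M ∈ ConfC1 r, ∀ j, 0 < ∑ k, bumpWeight B k j M := by
    intro M hM j
    obtain ⟨i, hi⟩ := hcov j M hM
    refine Finset.sum_pos' (fun k _ => bumpWeight_nonneg B k j M) ⟨i, Finset.mem_univ i, ?_⟩
    rw [bumpWeight, Metric.infDist_zero_of_mem hi, sub_zero]
    exact lt_max_of_lt_right (div_pos (hpos M hM) (by simp; omega))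
  refine ⟨fun M i => (∑ j, bumpWeight B i j M / ∑ k, bumpWeight B k j M) / r, ?_, ?_, ?_⟩
  · refine continuousOn_pi.2 fun i => ContinuousOn.div_const
      (continuousOn_finsetSum _ fun j _ => ?_) _
    exact (continuous_bumpWeight B i j).continuousOn.div
      (continuous_finsetSum _ fun k _ => continuous_bumpWeight B k j).continuousOn
      fun M hM => (hsum M hM j).ne'
  · intro σ M _
    have hw := bumpWeight_eq_of_infDist_eq σ (hdist σ M)
    funext i
    refine congrArg (· / (r : ℝ)) (Finset.sum_congr rfl fun j _ => ?_)
    have hnum := hw (σ⁻¹ i) j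
    rw [← Equiv.Perm.mul_apply, mul_inv_cancel, Equiv.Perm.one_apply] at hnum
    rw [hnum, ← Equiv.sum_comp σ fun k => bumpWeight B k j (rowPerm σ M)]
    simp only [hw]
  · intro M hM
    have hcol : ∀ j, ∑ i, bumpWeight B i j M / ∑ k, bumpWeight B k j M = 1 := fun j => by
      rw [← Finset.sum_div, div_self (hsum M hM j).ne']
    have hnonneg : ∀ i j, 0 ≤ bumpWeight B i j M / ∑ k, bumpWeight B k j M := fun i j =>
      div_nonneg (bumpWeight_nonneg B i j M) (hsum M hM j).le
    refine ⟨fun i => div_nonneg (Finset.sum_nonneg fun j _ => hnonneg i j) r.cast_nonneg, ?_, ?_⟩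
    · rw [← Finset.sum_div, Finset.sum_comm]
      simp [hcol, hr0]
    · intro hbary
      have hrow : ∀ i, ∑ j, bumpWeight B i j M / ∑ k, bumpWeight B k j M = 1 := fun i => by
        have := congrFun hbary i
        field_simp at this
        exact this
      obtain ⟨σ, hσ⟩ := exists_perm_pos_of_mem_doublyStochastic
        (A := Matrix.of fun i j => bumpWeight B i j M / ∑ k, bumpWeight B k j M)
        (mem_doublyStochastic_iff_sum.2 ⟨hnonneg, hrow, hcol⟩)
      obtain ⟨j, hj⟩ := exists_bumpWeight_eq_zero B σ M
      simpa [hj] using hσ j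
end
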